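/- If (F, D) is a duality pair of Δ-structures and D is a core, then D is connected (its shadow is a connected multigraph). -/

import Mathlib

/-! Framework: finite relational structures of a fixed type Δ = (δ i : i ∈ I),
homomorphisms, cores, sums, products, exponentials, shadows, trees, forests,
duality pairs, finite dualities, transversals, antichains. -/

namespace ThesisFormal

/-- A finite relational structure of type `Δ = (δ i : i ∈ I)`:
a finite nonempty base set together with a `δ i`-ary relation for each `i ∈ I`. -/
structure RelStruct (I : Type) (δ : I → ℕ) : Type 1 where
  carrier : Type
  finite : Finite carrier
  nonempty : Nonempty carrier
  rel : ∀ i : I, Set ((Fin (δ i)) → carrier)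

namespace RelStruct

variable {I : Type} {δ : I → ℕ}

/-- `f` is a homomorphism from `A` to `B`. -/
def IsHom (A B : RelStruct I δ) (f : A.carrier → B.carrier) : Prop :=
  ∀ i : I, ∀ e ∈ A.rel i, (f ∘ e) ∈ B.rel i

/-- `A → B`: some homomorphism from `A` to `B` exists. -/
def HomTo (A B : RelStruct I δ) : Prop := ∃ f, IsHom A B f

/-- `A ≈ B`: homomorphic equivalence. -/
def HomEquiv (A B : RelStruct I δ) : Prop := HomTo A B ∧ HomTo B A

/-- `A` and `B` are incomparable: no homomorphism either way. -/
def Incomparable (A B : RelStruct I δ) : Prop := ¬ HomTo A B ∧ ¬ HomTo B A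

/-- `A ≅ B`: a bijective homomorphism whose inverse is also a homomorphism. -/
def Isomorphic (A B : RelStruct I δ) : Prop :=
  ∃ f : A.carrier ≃ B.carrier, IsHom A B f ∧ IsHom B A f.symm

/-- A retraction of `A`: an endomorphism fixing its image pointwise. -/
def IsRetraction (A : RelStruct I δ) (f : A.carrier → A.carrier) : Prop :=
  IsHom A A f ∧ ∀ x ∈ Set.range f, f x = x

/-- A core: a structure with no proper retracts (every retraction is surjective). -/
def IsCore (A : RelStruct I δ) : Prop :=
  ∀ f, IsRetraction A f → Function.Surjective f

/-- The substructure of `A` induced by a nonempty `S ⊆ |A|`. -/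
noncomputable def Substruct (A : RelStruct I δ) (S : Set A.carrier) (hS : S.Nonempty) :
    RelStruct I δ where
  carrier := S
  finite := by haveI := A.finite; exact Subtype.finite
  nonempty := hS.to_subtype
  rel i := {e | (fun j => (e j : A.carrier)) ∈ A.rel i}

/-- `C` is a retract of `A`: the substructure induced by the image of a retraction. -/
def IsRetractOf (C A : RelStruct I δ) : Prop :=
  ∃ f, IsRetraction A f ∧
    C = A.Substruct (Set.range f) ⟨f A.nonempty.some, Set.mem_range_self _⟩

/-- The sum (disjoint union) `A + B`. -/
noncomputable def sum (A B : RelStruct I δ) : RelStruct I δ where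
  carrier := A.carrier ⊕ B.carrier
  finite := by haveI := A.finite; haveI := B.finite; infer_instance
  nonempty := ⟨Sum.inl A.nonempty.some⟩
  rel i := {e | (∃ ea ∈ A.rel i, e = Sum.inl ∘ ea) ∨ (∃ eb ∈ B.rel i, e = Sum.inr ∘ eb)}

/-- The product `A × B`. -/
noncomputable def prod (A B : RelStruct I δ) : RelStruct I δ where
  carrier := A.carrier × B.carrier
  finite := by haveI := A.finite; haveI := B.finite; infer_instance
  nonempty := ⟨(A.nonempty.some, B.nonempty.some)⟩
  rel i := {e | (fun j => (e j).1) ∈ A.rel i ∧ (fun j => (e j).2) ∈ B.rel i}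

/-- The exponential structure `C ^ B`. -/
noncomputable def exp (C B : RelStruct I δ) : RelStruct I δ where
  carrier := B.carrier → C.carrier
  finite := by haveI := B.finite; haveI := C.finite; infer_instance
  nonempty := ⟨fun _ => C.nonempty.some⟩
  rel i := {f | ∀ e ∈ B.rel i, (fun j => f j (e j)) ∈ C.rel i}

/-- The sum of a finite nonempty family of structures. -/
noncomputable def sigmaSum {J : Type} (hJfin : Finite J) (hJne : Nonempty J)
    (A : J → RelStruct I δ) : RelStruct I δ where
  carrier := Σ j, (A j).carrier
  finite := by
    haveI := hJfin
    haveI : ∀ j, Finite ((A j).carrier) := fun j => (A j).finite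
    infer_instance
  nonempty := ⟨⟨hJne.some, (A hJne.some).nonempty.some⟩⟩
  rel i := {e | ∃ j, ∃ ea ∈ (A j).rel i, e = fun k => ⟨j, ea k⟩}

/-- The product of a finite family of structures. -/
noncomputable def piProd {J : Type} (hJfin : Finite J)
    (A : J → RelStruct I δ) : RelStruct I δ where
  carrier := ∀ j, (A j).carrier
  finite := by
    haveI := hJfin
    haveI : ∀ j, Finite ((A j).carrier) := fun j => (A j).finite
    infer_instance
  nonempty := ⟨fun j => (A j).nonempty.some⟩
  rel i := {e | ∀ j, (fun k => e k j) ∈ (A j).rel i}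

/-- An edge of the shadow multigraph `Sh(A)`: one edge joining `e j` and `e (j+1)`
for each edge `e ∈ R i (A)` and each `j` with `j + 1 < δ i`. -/
structure ShadowEdge (A : RelStruct I δ) : Type where
  i : I
  e : Fin (δ i) → A.carrier
  mem : e ∈ A.rel i
  j : ℕ
  hj : j + 1 < δ i

/-- First endpoint of a shadow edge. -/
def ShadowEdge.src {A : RelStruct I δ} (s : ShadowEdge A) : A.carrier :=
  s.e ⟨s.j, Nat.lt_of_succ_lt s.hj⟩

/-- Second endpoint of a shadow edge. -/
def ShadowEdge.tgt {A : RelStruct I δ} (s : ShadowEdge A) : A.carrier :=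
  s.e ⟨s.j + 1, s.hj⟩

/-- The adjacency relation of the shadow `Sh(A)`. -/
def shadowAdj (A : RelStruct I δ) (a b : A.carrier) : Prop :=
  ∃ s : ShadowEdge A, (s.src = a ∧ s.tgt = b) ∨ (s.src = b ∧ s.tgt = a)

/-- The shadow of `A` is connected. -/
def ShadowConnected (A : RelStruct I δ) : Prop :=
  ∀ a b : A.carrier, Relation.ReflTransGen (shadowAdj A) a b

/-- `A` is a Δ-tree: its shadow multigraph is a tree, i.e. it is connected and
the number of edge occurrences is one less than the number of vertices
(this rules out cycles, loops and parallel edges). -/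
def IsTreeStruct (A : RelStruct I δ) : Prop :=
  ShadowConnected A ∧ Nat.card (ShadowEdge A) + 1 = Nat.card A.carrier

/-- The number of connected components of the shadow of `A`. -/
noncomputable def numComponents (A : RelStruct I δ) : ℕ :=
  Nat.card (Quot (shadowAdj A))

/-- `A` is a Δ-forest: every component of its shadow multigraph is a tree. -/
def IsForestStruct (A : RelStruct I δ) : Prop :=
  Nat.card (ShadowEdge A) + numComponents A = Nat.card A.carrier

/-- The component of `A` containing the vertex `a`. -/
noncomputable def componentOf (A : RelStruct I δ) (a : A.carrier) : RelStruct I δ :=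
  A.Substruct {b | Relation.ReflTransGen (shadowAdj A) a b}
    ⟨a, Relation.ReflTransGen.refl⟩

/-- `(F, D)` is a duality pair: for every `A`, `F → A` iff `A ↛ D`. -/
def DualityPair (F D : RelStruct I δ) : Prop :=
  ∀ A : RelStruct I δ, HomTo F A ↔ ¬ HomTo A D

/-- `(F, D)` is a finite homomorphism duality: `F` and `D` are finite sets of
pairwise incomparable cores and for every `X`, some member of `F` maps to `X`
iff `X` maps to no member of `D`. -/
def FiniteDuality (F D : Set (RelStruct I δ)) : Prop :=
  F.Finite ∧ D.Finite ∧
  (∀ A ∈ F, IsCore A) ∧ (∀ A ∈ D, IsCore A) ∧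
  F.Pairwise Incomparable ∧ D.Pairwise Incomparable ∧
  ∀ X : RelStruct I δ, (∃ A ∈ F, HomTo A X) ↔ (∀ B ∈ D, ¬ HomTo X B)

/-- The set of connected components of `A`. -/
def componentsSet (A : RelStruct I δ) : Set (RelStruct I δ) :=
  {C | ∃ a : A.carrier, C = componentOf A a}

/-- The set `ℱ_c` of connected components of the members of `F`. -/
def componentsOfFamily (F : Set (RelStruct I δ)) : Set (RelStruct I δ) :=
  ⋃ A ∈ F, componentsSet A

/-- A quasitransversal over `F`: a set of pairwise incomparable components of
members of `F` supporting `F`. -/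
def Quasitransversal (F M : Set (RelStruct I δ)) : Prop :=
  M ⊆ componentsOfFamily F ∧ M.Pairwise Incomparable ∧
  ∀ A ∈ F, ∃ C ∈ M, HomTo C A

/-- The order on quasitransversals: `M ⪯ M'` iff every member of `M'` admits a
homomorphism from some member of `M`. -/
def QTle (M M' : Set (RelStruct I δ)) : Prop :=
  ∀ C' ∈ M', ∃ C ∈ M, HomTo C C'

/-- A transversal: a `⪯`-maximal quasitransversal. -/
def IsTransversal (F M : Set (RelStruct I δ)) : Prop :=
  Quasitransversal F M ∧ ∀ M', Quasitransversal F M' → QTle M M' → M' = M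

/-- The product of a family of structures indexed by `Fin n`. -/
noncomputable def finProd (n : ℕ) (A : Fin n → RelStruct I δ) : RelStruct I δ :=
  piProd (inferInstance : Finite (Fin n)) A

/-- `D` is (isomorphic to) `D(M)`, the core of the product of the duals `D(C)`
of the members `C` of the finite set `M`. -/
def IsSetDual (M : Set (RelStruct I δ)) (D : RelStruct I δ) : Prop :=
  IsCore D ∧ ∃ (n : ℕ) (C DC : Fin n → RelStruct I δ),
    Function.Injective C ∧ Set.range C = M ∧
    (∀ k, IsCore (DC k) ∧ DualityPair (C k) (DC k)) ∧
    HomEquiv D (finProd n DC)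

/-- `D` is the result (up to isomorphism) of the transversal construction on `F`:
its members are exactly the duals of the transversals over `F`, one for each
transversal. -/
def TransversalDualSet (F D : Set (RelStruct I δ)) : Prop :=
  (∀ d ∈ D, ∃ M, IsTransversal F M ∧ IsSetDual M d) ∧
  (∀ M, IsTransversal F M → ∃ d ∈ D, IsSetDual M d) ∧
  (∀ d ∈ D, ∀ d' ∈ D, ∀ M : Set (RelStruct I δ),
    IsSetDual M d → IsSetDual M d' → d = d')

/-- `Q` is a maximal antichain in the homomorphism order: a set of pairwise
incomparable cores such that every structure is comparable with some member. -/
def IsMaxAntichain (Q : Set (RelStruct I δ)) : Prop :=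
  (∀ A ∈ Q, IsCore A) ∧ Q.Pairwise Incomparable ∧
  ∀ X : RelStruct I δ, ∃ A ∈ Q, HomTo X A ∨ HomTo A X

/-- The maximal antichain `Q` splits. -/
def Splits (Q : Set (RelStruct I δ)) : Prop :=
  ∃ Q₁ Q₂ : Set (RelStruct I δ), Q₁ ∪ Q₂ = Q ∧ Disjoint Q₁ Q₂ ∧
    ∀ X : RelStruct I δ, (∃ A ∈ Q₁, HomTo A X) ∨ (∃ B ∈ Q₂, HomTo X B)

/-- `A < B` in the homomorphism order. -/
def StrictHom (A B : RelStruct I δ) : Prop := HomTo A B ∧ ¬ HomTo B A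

/-- (The homomorphic-equivalence class of) `Y` is a cutting point in the
homomorphism order. -/
def CuttingPoint (Y : RelStruct I δ) : Prop :=
  ∃ X Z : RelStruct I δ, StrictHom X Y ∧ StrictHom Y Z ∧
    ∀ W : RelStruct I δ, HomTo X W → HomTo W Z → (HomTo W Y ∨ HomTo Y W)

/-- `A` has at most one edge of each kind. -/
def AtMostOneEdgePerKind (A : RelStruct I δ) : Prop :=
  ∀ i : I, ∀ e ∈ A.rel i, ∀ e' ∈ A.rel i, e = e'

end RelStruct

end ThesisFormal

namespace ThesisFormal

namespace RelStruct

variable {I : Type} {δ : I → ℕ}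

lemma IsHom.comp {A B C : RelStruct I δ} {g : B.carrier → C.carrier} {f : A.carrier → B.carrier}
    (hg : IsHom B C g) (hf : IsHom A B f) : IsHom A C (g ∘ f) :=
  fun i e he => hg i _ (hf i e he)

lemma HomTo.trans {A B C : RelStruct I δ} (hAB : HomTo A B) (hBC : HomTo B C) : HomTo A C := by
  obtain ⟨f, hf⟩ := hAB
  obtain ⟨g, hg⟩ := hBC
  exact ⟨g ∘ f, hg.comp hf⟩

lemma IsHom.iterate {A : RelStruct I δ} {f : A.carrier → A.carrier} (hf : IsHom A A f) (n : ℕ) :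
    IsHom A A f^[n] := by
  induction n with
  | zero => exact fun i e he => he
  | succ n ih => exact ih.comp hf

/-- `a` and `b` lie in the same component of the shadow of `A`. -/
abbrev Conn (A : RelStruct I δ) (a b : A.carrier) : Prop :=
  Relation.ReflTransGen (shadowAdj A) a b

lemma Conn.symm {A : RelStruct I δ} {a b : A.carrier} (h : Conn A a b) : Conn A b a :=
  have : Std.Symm (shadowAdj A) := ⟨fun _ _ ⟨s, hs⟩ => ⟨s, hs.symm⟩⟩
  Relation.ReflTransGen.stdSymm.symm _ _ h

lemma Conn.map {A B : RelStruct I δ} {f : A.carrier → B.carrier} (hf : IsHom A B f)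
    {a b : A.carrier} (h : Conn A a b) : Conn B (f a) (f b) := by
  refine Relation.ReflTransGen.lift f ?_ _ _ h
  rintro x y ⟨s, hs⟩
  refine ⟨⟨s.i, f ∘ s.e, hf _ _ s.mem, s.j, s.hj⟩, ?_⟩
  rcases hs with ⟨rfl, rfl⟩ | ⟨rfl, rfl⟩
  · exact Or.inl ⟨rfl, rfl⟩
  · exact Or.inr ⟨rfl, rfl⟩

lemma conn_of_mem_rel {A : RelStruct I δ} {i : I} {e : Fin (δ i) → A.carrier} (he : e ∈ A.rel i)
    (s t : Fin (δ i)) : Conn A (e s) (e t) := by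
  have key : ∀ n (hn : n < δ i), Conn A (e ⟨0, by omega⟩) (e ⟨n, hn⟩) := by
    intro n
    induction n with
    | zero => exact fun _ => .refl
    | succ n ih => exact fun hn => (ih (by omega)).tail ⟨⟨i, e, he, n, hn⟩, Or.inl ⟨rfl, rfl⟩⟩
  exact (key s s.2).symm.trans (key t t.2)

/-- Some positive iterate of an endomorphism of a core is the identity. -/
lemma IsCore.exists_iterate_eq_id {D : RelStruct I δ} (hD : D.IsCore)
    {g : D.carrier → D.carrier} (hg : IsHom D D g) : ∃ n, g^[n + 1] = id := by
  have := D.finite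
  obtain ⟨m, n, hmn, heq⟩ := Finite.exists_ne_map_eq_of_infinite (fun n : ℕ => g^[n])
  wlog hlt : m < n generalizing m n
  · exact this n m hmn.symm heq.symm (by omega)
  obtain ⟨p, rfl⟩ := Nat.exists_eq_add_of_lt hlt
  have hper : ∀ k c, g^[m + k + c * (p + 1)] = g^[m + k] := by
    intro k c
    induction c with
    | zero => simp
    | succ c ih =>
      rw [show m + k + (c + 1) * (p + 1) = (k + c * (p + 1)) + (m + p + 1) by ring,
        Function.iterate_add, ← show g^[m] = g^[m + p + 1] from heq, ← Function.iterate_add,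
        show k + c * (p + 1) + m = m + k + c * (p + 1) by ring, ih]
  obtain ⟨r, hr⟩ : ∃ r, (m + 1) * (p + 1) = r + 1 := ⟨m * (p + 1) + p, by ring⟩
  have hidem : g^[r + 1] ∘ g^[r + 1] = g^[r + 1] := by
    rw [← Function.iterate_add]
    have hle : m ≤ r + 1 := by rw [← hr]; nlinarith
    obtain ⟨k, hk⟩ := Nat.exists_eq_add_of_le hle
    have := hper k (m + 1)
    rwa [hr, ← hk] at this
  have hsurj := hD _ ⟨hg.iterate (r + 1), by rintro _ ⟨x, rfl⟩; exact congrFun hidem x⟩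
  refine ⟨r, funext fun x => ?_⟩
  obtain ⟨y, rfl⟩ := hsurj x
  exact congrFun hidem y

/-- A core does not map to a structure over it in which two of its components are joined. -/
lemma IsCore.not_homTo_of_conn {D A : RelStruct I δ} (hD : D.IsCore)
    {ι : D.carrier → A.carrier} (hι : IsHom D A ι) {a b : D.carrier} (hab : ¬ Conn D a b)
    (hA : Conn A (ι a) (ι b)) : ¬ HomTo A D := by
  rintro ⟨f, hf⟩
  obtain ⟨n, hn⟩ := hD.exists_iterate_eq_id (hf.comp hι)
  have := (hA.map hf).map ((hf.comp hι).iterate n)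
  change Conn D ((f ∘ ι)^[n] ((f ∘ ι) a)) ((f ∘ ι)^[n] ((f ∘ ι) b)) at this
  rw [← Function.iterate_succ_apply, ← Function.iterate_succ_apply, hn] at this
  exact hab this

/-- In a core with at least two elements, every element lies on an edge. -/
lemma IsCore.exists_mem_rel {D : RelStruct I δ} (hD : D.IsCore) {a b : D.carrier} (hab : a ≠ b) :
    ∃ i, ∃ e ∈ D.rel i, ∃ s, e s = a := by
  classical
  by_contra! hno
  have hsurj := hD (Function.update id a b) ⟨?_, ?_⟩
  · obtain ⟨x, hx⟩ := hsurj a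
    by_cases hxa : x = a
    · subst hxa
      exact hab (by simpa using hx.symm)
    · rw [Function.update_of_ne hxa] at hx
      exact hxa hx
  · intro i e he
    have : Function.update id a b ∘ e = e :=
      funext fun s => by simp [Function.update_of_ne (hno i e he s)]
    rwa [this]
  · rintro _ ⟨x, rfl⟩
    by_cases hxa : x = a
    · subst hxa
      simp [Function.update_of_ne hab.symm]
    · simp [hxa]

section Ribbon

variable (Z : RelStruct I δ) {i : I} (e e' : Fin (δ i) → Z.carrier) (N : ℕ)

/-- The `k`-th of `N` intermediate copies of position `s` between the edges `e` and `e'`;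
the copies with `k = 0` and `N ≤ k` are those of `e` and `e'`. -/
def ribbonVertex (s : Fin (δ i)) (k : ℕ) : Z.carrier ⊕ (Fin (δ i) × Fin N) :=
  if k = 0 then Sum.inl (e s) else if h : k < N then Sum.inr (s, ⟨k, h⟩) else Sum.inl (e' s)

/-- `Z` with its edges `e` and `e'` joined by a ribbon of edges of the same kind, whose
vertices lie on at most two consecutive levels. -/
def ribbon : RelStruct I δ where
  carrier := Z.carrier ⊕ (Fin (δ i) × Fin N)
  finite := by have := Z.finite; infer_instance
  nonempty := ⟨Sum.inl Z.nonempty.some⟩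
  rel k := {z | (∃ ez ∈ Z.rel k, z = Sum.inl ∘ ez) ∨
    ∃ κ : Fin (δ i) → ℕ, (∀ s t, κ s ≤ κ t + 1) ∧
      (⟨k, z⟩ : Σ k, Fin (δ k) → Z.carrier ⊕ (Fin (δ i) × Fin N)) =
        ⟨i, fun s => ribbonVertex Z e e' N s (κ s)⟩}

lemma isHom_inl_ribbon : IsHom Z (ribbon Z e e' N) Sum.inl :=
  fun _ ez hez => Or.inl ⟨ez, hez, rfl⟩

variable {Z e e' N}

lemma conn_ribbon (hδ : 2 ≤ δ i) (hN : 0 < N) (s t : Fin (δ i)) :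
    Conn (ribbon Z e e' N) (Sum.inl (e s)) (Sum.inl (e' t)) := by
  have hmem : ∀ κ : Fin (δ i) → ℕ, (∀ s t, κ s ≤ κ t + 1) →
      (fun s => ribbonVertex Z e e' N s (κ s)) ∈ (ribbon Z e e' N).rel i :=
    fun κ hκ => Or.inr ⟨κ, hκ, rfl⟩
  have key : ∀ k t, Conn (ribbon Z e e' N) (ribbonVertex Z e e' N s 0)
      (ribbonVertex Z e e' N t k) := by
    intro k
    induction k with
    | zero => exact fun t => conn_of_mem_rel (hmem (fun _ => 0) (by simp)) s t
    | succ k ih =>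
      intro t
      have : Nontrivial (Fin (δ i)) := Fin.nontrivial_iff_two_le.2 hδ
      obtain ⟨r, hr⟩ := exists_ne t
      have := conn_of_mem_rel (hmem (fun x => if x = r then k else k + 1)
        (fun x y => by split_ifs <;> omega)) r t
      simp only [if_true, if_neg hr.symm] at this
      exact (ih r).trans this
  have := key N t
  simpa [ribbonVertex, hN.ne'] using this

/-- A structure with too few elements to meet every level of the ribbon maps to `Z`. -/
lemma homTo_of_homTo_ribbon (he : e ∈ Z.rel i) (he' : e' ∈ Z.rel i) {F : RelStruct I δ}
    (hN : Nat.card F.carrier + 2 ≤ N) (h : HomTo F (ribbon Z e e' N)) : HomTo F Z := by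
  have := F.finite
  obtain ⟨f, hf⟩ : ∃ f : F.carrier → Z.carrier ⊕ (Fin (δ i) × Fin N),
    IsHom F (ribbon Z e e' N) f := h
  obtain ⟨k, hk0, hkN, hk⟩ : ∃ k, 0 < k ∧ ∃ hkN : k < N, ∀ w s, f w ≠ Sum.inr (s, ⟨k, hkN⟩) := by
    by_contra! hall
    choose w s hw using fun k : Fin (Nat.card F.carrier + 1) =>
      hall (k + 1) (Nat.succ_pos _) (by omega)
    have hinj : Function.Injective w := by
      intro x y hxy
      have := (hw x).symm.trans ((congrArg f hxy).trans (hw y))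
      have := congrArg Prod.snd (Sum.inr.inj this)
      simp only [Fin.mk.injEq] at this
      omega
    have := Nat.card_le_card_of_injective w hinj
    simp at this
  let r : Z.carrier ⊕ (Fin (δ i) × Fin N) → Z.carrier :=
    Sum.elim id fun x => if (x.2 : ℕ) < k then e x.1 else e' x.1
  have hrlt : ∀ s l, l < k → r (ribbonVertex Z e e' N s l) = e s := by
    intro s l hl
    by_cases hl0 : l = 0
    · simp [r, ribbonVertex, hl0]
    · simp [r, ribbonVertex, hl0, hl, hl.trans hkN]
  have hrge : ∀ s l, k ≤ l → r (ribbonVertex Z e e' N s l) = e' s := by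
    intro s l hl
    have hl0 : l ≠ 0 := by omega
    by_cases hlN : l < N
    · simp [r, ribbonVertex, hl0, hlN, hl]
    · simp [r, ribbonVertex, hl0, hlN]
  refine ⟨r ∘ f, fun j z hz => ?_⟩
  have hfz := hf j z hz
  rcases hfz with ⟨ez, hez, heq⟩ | ⟨κ, hκ, heq⟩
  · change r ∘ (f ∘ z) ∈ Z.rel j
    have hfz : f ∘ z = Sum.inl ∘ ez := heq
    rwa [hfz]
  · obtain rfl : j = i := congrArg Sigma.fst heq
    have hfz : f ∘ z = fun s => ribbonVertex Z e e' N s (κ s) :=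
      eq_of_heq (Sigma.mk.inj heq).2
    have hne : ∀ s, κ s ≠ k := by
      intro s hs
      have hzs := congrFun hfz s
      simp only [ribbonVertex, hs, hk0.ne', hkN, if_false, dif_pos] at hzs
      exact hk _ s hzs
    change r ∘ (f ∘ z) ∈ Z.rel j
    rw [hfz]
    by_cases hlt : ∀ s, κ s < k
    · rwa [show (r ∘ fun s => ribbonVertex Z e e' N s (κ s)) = e from
        funext fun s => hrlt s _ (hlt s)]
    · push Not at hlt
      obtain ⟨t, ht⟩ := hlt
      have hge : ∀ s, k ≤ κ s := fun s => by
        have := hκ t s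
        have := hne t
        omega
      rwa [show (r ∘ fun s => ribbonVertex Z e e' N s (κ s)) = e' from
        funext fun s => hrge s _ (hge s)]

end Ribbon

/-- If `D` is a core with two components, one having an edge of kind `i` and the other one of
kind `j`, then its partner in a duality pair maps to every structure in which edges of kinds
`i` and `j` are joined. -/
lemma DualityPair.homTo_of_conn (hδ : ∀ i, 2 ≤ δ i) {F D : RelStruct I δ} (h : DualityPair F D)
    (hD : D.IsCore) {i j : I} {e₁ : Fin (δ i) → D.carrier} {e₂ : Fin (δ j) → D.carrier}
    (he₁ : e₁ ∈ D.rel i) (he₂ : e₂ ∈ D.rel j) {s : Fin (δ i)} {t : Fin (δ j)}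
    (hne : ¬ Conn D (e₁ s) (e₂ t)) {Q : RelStruct I δ} {x : Fin (δ i) → Q.carrier}
    {y : Fin (δ j) → Q.carrier} (hx : x ∈ Q.rel i) (hy : y ∈ Q.rel j)
    (hQ : Conn Q (x s) (y t)) : HomTo F Q := by
  have hinl : IsHom D (D.sum Q) Sum.inl := fun _ e he => Or.inl ⟨e, he, rfl⟩
  have hinr : IsHom Q (D.sum Q) Sum.inr := fun _ e he => Or.inr ⟨e, he, rfl⟩
  let N := Nat.card F.carrier + 2
  have hN : 0 < N := Nat.succ_pos _
  let B := ribbon (D.sum Q) (Sum.inl ∘ e₁) (Sum.inr ∘ x) N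
  have hB : IsHom (D.sum Q) B Sum.inl := isHom_inl_ribbon _ _ _ _
  let C := ribbon B (Sum.inl ∘ Sum.inr ∘ y) (Sum.inl ∘ Sum.inl ∘ e₂) N
  have hC : IsHom B C Sum.inl := isHom_inl_ribbon _ _ _ _
  have hconn : Conn C (Sum.inl (Sum.inl (Sum.inl (e₁ s)))) (Sum.inl (Sum.inl (Sum.inl (e₂ t)))) :=
    (((conn_ribbon (hδ i) hN s s : Conn B _ _).map hC).trans
      (((hQ.map hinr).map hB).map hC)).trans (conn_ribbon (hδ j) hN t t)
  have hFC : HomTo F C :=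
    (h C).2 (hD.not_homTo_of_conn ((hC.comp hB).comp hinl) hne hconn)
  have hFB : HomTo F B := homTo_of_homTo_ribbon (hB _ _ (hinr _ _ hy)) (hB _ _ (hinl _ _ he₂))
    le_rfl hFC
  have hFS : HomTo F (D.sum Q) :=
    homTo_of_homTo_ribbon (hinl _ _ he₁) (hinr _ _ hx) le_rfl hFB
  refine (h Q).2 ?_
  rintro ⟨f, hf⟩
  refine (h (D.sum Q)).1 hFS ⟨Sum.elim id f, ?_⟩
  rintro k _ (⟨ea, hea, rfl⟩ | ⟨eb, heb, rfl⟩)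
  · exact hea
  · exact hf k eb heb

/-- The structure on `V` whose only edges are `x`, of kind `i`, and `y`, of kind `j`. -/
def twoEdges (V : Type) [hV : Finite V] [hV' : Nonempty V] {i j : I} (x : Fin (δ i) → V)
    (y : Fin (δ j) → V) : RelStruct I δ where
  carrier := V
  finite := hV
  nonempty := hV'
  rel k := {z | (⟨k, z⟩ : Σ k, Fin (δ k) → V) = ⟨i, x⟩ ∨ (⟨k, z⟩ : Σ k, Fin (δ k) → V) = ⟨j, y⟩}

lemma DualityPair.homTo_twoEdges (hδ : ∀ i, 2 ≤ δ i) {F D : RelStruct I δ} (h : DualityPair F D)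
    (hD : D.IsCore) {i j : I} {e₁ : Fin (δ i) → D.carrier} {e₂ : Fin (δ j) → D.carrier}
    (he₁ : e₁ ∈ D.rel i) (he₂ : e₂ ∈ D.rel j) {s : Fin (δ i)} {t : Fin (δ j)}
    (hne : ¬ Conn D (e₁ s) (e₂ t)) (V : Type) [Finite V] [Nonempty V] (x : Fin (δ i) → V)
    (y : Fin (δ j) → V) {p : Fin (δ i)} {q : Fin (δ j)} (hpq : x p = y q) :
    HomTo F (twoEdges V x y) := by
  have hx : x ∈ (twoEdges V x y).rel i := Or.inl rfl
  have hy : y ∈ (twoEdges V x y).rel j := Or.inr rfl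
  refine h.homTo_of_conn hδ hD he₁ he₂ hne hx hy ?_
  have hxp := conn_of_mem_rel hx s p
  rw [hpq] at hxp
  exact hxp.trans (conn_of_mem_rel hy q t)

/-- An edge of kind `i` and an edge of kind `j ≠ i`, sharing the vertex at position `p` of the
former and `q` of the latter. -/
noncomputable def gluedEdges {i j : I} (p : Fin (δ i)) (q : Fin (δ j)) : RelStruct I δ :=
  haveI : Nonempty (Fin (δ i) ⊕ Fin (δ j)) := ⟨Sum.inl p⟩
  twoEdges (Fin (δ i) ⊕ Fin (δ j)) (Function.update Sum.inl p (Sum.inr q)) Sum.inr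

/-- The product of two gluings of an `i`-edge and a `j`-edge at different positions of the
former consists of two disjoint edges. -/
lemma homTo_of_homTo_gluedEdges {F D : RelStruct I δ} {i j : I} (hij : i ≠ j)
    {e₁ : Fin (δ i) → D.carrier} {e₂ : Fin (δ j) → D.carrier} (he₁ : e₁ ∈ D.rel i)
    (he₂ : e₂ ∈ D.rel j) {p p' : Fin (δ i)} (hp : p ≠ p') {q q' : Fin (δ j)}
    (h : HomTo F (gluedEdges p q)) (h' : HomTo F (gluedEdges p' q')) : HomTo F D := by
  obtain ⟨f, hf⟩ := h
  obtain ⟨f', hf'⟩ := h'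
  let φ : Fin (δ i) ⊕ Fin (δ j) → Fin (δ i) ⊕ Fin (δ j) → D.carrier := fun u v =>
    Sum.elim e₁ (fun t => Sum.elim e₁ (fun _ => e₂ t) v) u
  refine ⟨fun w => φ (f w) (f' w), fun k z hz => ?_⟩
  have hfz := hf k z hz
  have hfz' := hf' k z hz
  rcases hfz with hfz | hfz
  · obtain rfl : k = i := congrArg Sigma.fst hfz
    rcases hfz' with hfz' | hfz'
    · have h1 : f ∘ z = Function.update Sum.inl p (Sum.inr q) :=
        eq_of_heq (Sigma.mk.inj hfz).2
      have h2 : f' ∘ z = Function.update Sum.inl p' (Sum.inr q') :=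
        eq_of_heq (Sigma.mk.inj hfz').2
      convert he₁ using 1
      funext s
      have h1s := congrFun h1 s
      have h2s := congrFun h2 s
      simp only [Function.comp_apply] at h1s h2s ⊢
      rw [h1s, h2s]
      by_cases hs : s = p
      · subst hs
        simp [φ, hp]
      · simp [φ, hs]
    · exact absurd (congrArg Sigma.fst hfz') hij
  · obtain rfl : k = j := congrArg Sigma.fst hfz
    rcases hfz' with hfz' | hfz'
    · exact absurd (congrArg Sigma.fst hfz').symm hij
    · have h1 : f ∘ z = Sum.inr :=
        eq_of_heq (Sigma.mk.inj hfz).2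
      have h2 : f' ∘ z = Sum.inr :=
        eq_of_heq (Sigma.mk.inj hfz').2
      convert he₂ using 1
      funext s
      have h1s := congrFun h1 s
      have h2s := congrFun h2 s
      simp only [Function.comp_apply] at h1s h2s ⊢
      rw [h1s, h2s]
      simp [φ]

end RelStruct

end ThesisFormal

open ThesisFormal RelStruct in
/-- If `(F, D)` is a duality pair and `D` is a core, then `D`
is connected (its shadow is connected). -/
theorem stmt_12 {I : Type} [Finite I] {δ : I → ℕ} (hδ : ∀ i, 2 ≤ δ i)
    (F D : RelStruct I δ) (h : DualityPair F D) (hD : D.IsCore) :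
    ShadowConnected D := by
  intro a b
  by_contra hab
  have hne : a ≠ b := by rintro rfl; exact hab .refl
  have hFD : ¬ HomTo F D := (h F).1 ⟨id, fun _ _ he => he⟩
  obtain ⟨i, e₁, he₁, s, rfl⟩ := hD.exists_mem_rel hne
  obtain ⟨j, e₂, he₂, t, rfl⟩ := hD.exists_mem_rel hne.symm
  by_cases hij : i = j
  · subst hij
    have := D.finite
    have := D.nonempty
    refine hFD ((h.homTo_twoEdges hδ hD he₁ he₂ hab D.carrier e₁ e₁ (p := s) (q := s) rfl).trans
      ⟨id, ?_⟩)
    intro k z hz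
    have heq : (⟨k, z⟩ : Σ k, Fin (δ k) → D.carrier) = ⟨i, e₁⟩ := hz.elim id id
    cases heq
    exact he₁
  · have : Nontrivial (Fin (δ i)) := Fin.nontrivial_iff_two_le.2 (hδ i)
    obtain ⟨p, hp⟩ := exists_ne s
    have hglue : ∀ r : Fin (δ i), HomTo F (gluedEdges r t) := fun r =>
      haveI : Nonempty (Fin (δ i) ⊕ Fin (δ j)) := ⟨Sum.inl r⟩
      h.homTo_twoEdges hδ hD he₁ he₂ hab _ _ _ (p := r) (q := t) (by simp)
    exact hFD (homTo_of_homTo_gluedEdges hij he₁ he₂ hp (hglue p) (hglue s))
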